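/- In the setting of the augmented Lagrangian L_ρ, let F be differentiable with L-Lipschitz gradient (L > 0), let each g_j be convex, let A ∈ ℝ^{p×d} have AAᵀ positive definite with smallest eigenvalue λ > 0, let σ_A ≥ 0 be the smallest eigenvalue of AᵀA, let G ∈ ℝ^{d×d} be symmetric positive semidefinite, let each H_j ∈ ℝ^{l×l} be symmetric positive definite, and let η, ρ, C > 0. Define c_R = 3‖G‖²/(ρλη²) + 9L²/(ρλ), Λ = λ_min(G)/η + ρσ_A/2 − L − 6‖G‖²/(ρλη²) − 9L²/(ρλ), and the potential R(x, x⁻, y, z) = L_ρ(x, y, z) + c_R‖x − x⁻‖². Suppose points x^{k−1}, x^k, x^{k+1}, v^{k−1}, v^k ∈ ℝ^d, blocks y^k = (y^k_1,…,y^k_m), y^{k+1} = (y^{k+1}_1,…,y^{k+1}_m) in (ℝ^l)^m, and z^k, z^{k+1} ∈ ℝ^p satisfy: (i) for each j, some subgradient u_j of g_j at y^{k+1}_j satisfies u_j − B_jᵀz^k + ρB_jᵀ(Ax^k + Σ_{i≤j} B_i y^{k+1}_i + Σ_{i>j} B_i y^k_i − c) + H_j(y^{k+1}_j − y^k_j)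 = 0; (ii) v^k + (1/η)G(x^{k+1} − x^k) − Aᵀz^k + ρAᵀ(Ax^{k+1} + Σ_j B_j y^{k+1}_j − c) = 0; (iii) z^{k+1} = z^k − ρ(Ax^{k+1} + Σ_j B_j y^{k+1}_j − c); (iv) Aᵀz^k = v^{k−1} + (1/η)G(x^k − x^{k−1}); (v) ‖v^k − ∇F(x^k)‖² ≤ C and ‖v^{k−1} − ∇F(x^{k−1})‖² ≤ C. Then R(x^{k+1}, x^k, y^{k+1}, z^{k+1}) ≤ R(x^k, x^{k−1}, y^k, z^k) − Λ‖x^{k+1} − x^k‖² − Σ_{j=1}^m λ_min(H_j)‖y^{k+1}_j − y^k_j‖² + C/(2L) + 18C/(ρλ). -/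

import Mathlib

open ContinuousLinearMap
open scoped RealInnerProductSpace

/-- The augmented Lagrangian `L_ρ(x, y, z)`. -/
noncomputable def augLag {d l p m : ℕ}
    (F : EuclideanSpace ℝ (Fin d) → ℝ)
    (g : Fin m → EuclideanSpace ℝ (Fin l) → ℝ)
    (A : EuclideanSpace ℝ (Fin d) →L[ℝ] EuclideanSpace ℝ (Fin p))
    (B : Fin m → EuclideanSpace ℝ (Fin l) →L[ℝ] EuclideanSpace ℝ (Fin p))
    (c : EuclideanSpace ℝ (Fin p)) (ρ : ℝ)
    (x : EuclideanSpace ℝ (Fin d)) (y : Fin m → EuclideanSpace ℝ (Fin l))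
    (z : EuclideanSpace ℝ (Fin p)) : ℝ :=
  F x + ∑ j, g j (y j) - ⟪z, A x + ∑ j, B j (y j) - c⟫ +
    (ρ / 2) * ‖A x + ∑ j, B j (y j) - c‖ ^ 2

section Auxiliary

variable {E V W : Type*} [NormedAddCommGroup E] [InnerProductSpace ℝ E]
  [NormedAddCommGroup V] [InnerProductSpace ℝ V] [CompleteSpace V]
  [NormedAddCommGroup W] [InnerProductSpace ℝ W] [CompleteSpace W]

/-- The smallest spectral value of a self-adjoint operator bounds its quadratic form below. -/
theorem sInf_spectrum_mul_norm_sq_le_inner [FiniteDimensional ℝ V] {T : V →L[ℝ] V}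
    (hT : IsSelfAdjoint T) (x : V) :
    sInf (spectrum ℝ T) * ‖x‖ ^ 2 ≤ ⟪T x, x⟫ := by
  have hsym : (T : V →ₗ[ℝ] V).IsSymmetric := hT.isSymmetric
  let b := hsym.eigenvectorBasis rfl
  rw [← b.sum_sq_norm_inner_right x, ← b.sum_inner_mul_inner (T x) x, Finset.mul_sum]
  refine Finset.sum_le_sum fun i _ => ?_
  have hmem : hsym.eigenvalues rfl i ∈ spectrum ℝ T := by
    rw [ContinuousLinearMap.spectrum_eq]
    exact (hsym.hasEigenvalue_eigenvalues rfl i).mem_spectrum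
  have hle : sInf (spectrum ℝ T) ≤ hsym.eigenvalues rfl i :=
    csInf_le (spectrum.isBounded T).bddBelow hmem
  have heig : ⟪T x, b i⟫ = hsym.eigenvalues rfl i * ⟪b i, x⟫ := by
    have h := hsym x (b i)
    rw [hsym.apply_eigenvectorBasis rfl i] at h
    simpa [inner_smul_right, real_inner_comm] using h
  rw [heig, Real.norm_eq_abs, sq_abs, mul_assoc, ← sq]
  exact mul_le_mul_of_nonneg_right hle (sq_nonneg _)

theorem sInf_spectrum_adjoint_comp_self_mul_norm_sq_le [FiniteDimensional ℝ V] (A : V →L[ℝ] W)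
    (x : V) :
    sInf (spectrum ℝ (adjoint A ∘L A)) * ‖x‖ ^ 2 ≤ ‖A x‖ ^ 2 := by
  have h := sInf_spectrum_mul_norm_sq_le_inner (IsSelfAdjoint.adjoint_conj
    (IsSelfAdjoint.one (W →L[ℝ] W)) A) x
  have hA : adjoint A ∘L (1 : W →L[ℝ] W) ∘L A = adjoint A ∘L A := rfl
  rw [hA] at h
  simpa [adjoint_inner_left] using h

theorem sInf_spectrum_comp_adjoint_mul_norm_sq_le [FiniteDimensional ℝ W] (A : V →L[ℝ] W)
    (z : W) :
    sInf (spectrum ℝ (A ∘L adjoint A)) * ‖z‖ ^ 2 ≤ ‖adjoint A z‖ ^ 2 := by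
  simpa using sInf_spectrum_adjoint_comp_self_mul_norm_sq_le (adjoint A) z

/-- The descent lemma for a function with Lipschitz gradient. -/
theorem le_add_inner_gradient_add_of_lipschitz_gradient [CompleteSpace E] {F : E → ℝ} {L : ℝ}
    (hF : Differentiable ℝ F) (hL : ∀ a b, ‖gradient F a - gradient F b‖ ≤ L * ‖a - b‖)
    (x d : E) : F (x + d) ≤ F x + ⟪gradient F x, d⟫ + L / 2 * ‖d‖ ^ 2 := by
  let φ : ℝ → ℝ := fun t => F (x + t • d) - t * ⟪gradient F x, d⟫ - L / 2 * ‖d‖ ^ 2 * t ^ 2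
  have hφ : ∀ t, HasDerivAt φ (⟪gradient F (x + t • d), d⟫ - ⟪gradient F x, d⟫
      - L * ‖d‖ ^ 2 * t) t := by
    intro t
    have hline : HasDerivAt (fun t : ℝ => x + t • d) d t := by
      simpa using ((hasDerivAt_id t).smul_const d).const_add x
    have hcomp : HasDerivAt (fun t : ℝ => F (x + t • d)) ⟪gradient F (x + t • d), d⟫ t := by
      simpa [Function.comp_def] using
        (hF (x + t • d)).hasGradientAt.hasFDerivAt.comp_hasDerivAt t hline
    convert! (hcomp.sub ((hasDerivAt_id t).mul_const ⟪gradient F x, d⟫)).sub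
      (((hasDerivAt_id t).pow 2).const_mul (L / 2 * ‖d‖ ^ 2)) using 1
    simp
    ring
  have hanti : AntitoneOn φ (Set.Icc 0 1) := by
    refine antitoneOn_of_deriv_nonpos (convex_Icc 0 1)
      (fun t _ => (hφ t).continuousAt.continuousWithinAt)
      (fun t _ => (hφ t).differentiableAt.differentiableWithinAt) fun t ht => ?_
    rw [interior_Icc] at ht
    have hgrad := hL (x + t • d) x
    rw [add_sub_cancel_left, norm_smul, Real.norm_eq_abs, abs_of_pos ht.1] at hgrad
    have hinner := real_inner_le_norm (gradient F (x + t • d) - gradient F x) d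
    rw [inner_sub_left] at hinner
    rw [(hφ t).deriv]
    nlinarith [mul_le_mul_of_nonneg_right hgrad (norm_nonneg d)]
  have h := hanti (Set.left_mem_Icc.2 zero_le_one) (Set.right_mem_Icc.2 zero_le_one) zero_le_one
  simp only [φ, zero_smul, one_smul, add_zero] at h
  linarith

/-- Replacing the terms `b` of a sum by the terms `a` one at a time telescopes. -/
theorem sum_sub_eq_of_replace_one_by_one {M : Type*} [AddCommGroup M] {m : ℕ} (Φ : M → ℝ)
    (e : M) (a b : Fin m → M) :
    ∑ j, (Φ (e + (∑ i ∈ Finset.univ.filter (fun i => i ≤ j), a i)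
          + ∑ i ∈ Finset.univ.filter (fun i => j < i), b i)
        - Φ (e + (∑ i ∈ Finset.univ.filter (fun i => i ≤ j), a i)
          + (∑ i ∈ Finset.univ.filter (fun i => j < i), b i) - (a j - b j)))
      = Φ (e + ∑ j, a j) - Φ (e + ∑ j, b j) := by
  let q : ℕ → M := fun k => e + ∑ i : Fin m, if (i : ℕ) < k then a i else b i
  have hsucc : ∀ j : Fin m, e + (∑ i ∈ Finset.univ.filter (fun i => i ≤ j), a i)
      + ∑ i ∈ Finset.univ.filter (fun i => j < i), b i = q (j + 1) := by
    intro j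
    simp only [q, Finset.sum_ite, add_assoc, Nat.lt_succ_iff, Fin.val_fin_le, not_le]
  have hstep : ∀ j : Fin m, q (j + 1) - (a j - b j) = q j := by
    intro j
    have hsum : ∑ i : Fin m, (if (i : ℕ) < j + 1 then a i else b i)
        = ∑ i : Fin m, ((if (i : ℕ) < j then a i else b i) + if i = j then a j - b j else 0) := by
      refine Finset.sum_congr rfl fun i _ => ?_
      rcases lt_trichotomy i j with h | h | h
      · simp [h, h.ne, Nat.lt_succ_of_lt (Fin.lt_def.1 h)]
      · simp [h]
      · have h' : ¬ (i : ℕ) < j + 1 := by have := Fin.lt_def.1 h; omega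
        simp [h', h.ne', not_lt.2 h.le]
    simp only [q, hsum, Finset.sum_add_distrib, Finset.sum_ite_eq', Finset.mem_univ, if_true]
    abel
  simp only [hsucc, hstep]
  rw [Fin.sum_univ_eq_sum_range (fun k => Φ (q (k + 1)) - Φ (q k)) m,
    Finset.sum_range_sub (fun k => Φ (q k))]
  simp [q]

theorem norm_add_add_sq_le {X : Type*} [SeminormedAddCommGroup X] (a b c : X) :
    ‖a + b + c‖ ^ 2 ≤ 3 * (‖a‖ ^ 2 + ‖b‖ ^ 2 + ‖c‖ ^ 2) := by
  have h : ‖a + b + c‖ ≤ ‖a‖ + ‖b‖ + ‖c‖ := norm_add₃_le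
  nlinarith [norm_nonneg (a + b + c), sq_nonneg (‖a‖ - ‖b‖), sq_nonneg (‖b‖ - ‖c‖),
    sq_nonneg (‖a‖ - ‖c‖)]

end Auxiliary

section Steps

variable {d l p m : ℕ} {F : EuclideanSpace ℝ (Fin d) → ℝ}
  {g : Fin m → EuclideanSpace ℝ (Fin l) → ℝ}
  {A : EuclideanSpace ℝ (Fin d) →L[ℝ] EuclideanSpace ℝ (Fin p)}
  {B : Fin m → EuclideanSpace ℝ (Fin l) →L[ℝ] EuclideanSpace ℝ (Fin p)}
  {c : EuclideanSpace ℝ (Fin p)} {ρ : ℝ}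

/-- Decrease of the augmented Lagrangian under the Gauss–Seidel sweep over the blocks. -/
theorem augLag_block_update_le
    {H : Fin m → (EuclideanSpace ℝ (Fin l) →L[ℝ] EuclideanSpace ℝ (Fin l))}
    (hρ : 0 < ρ) (hH : ∀ j, IsSelfAdjoint (H j)) {x : EuclideanSpace ℝ (Fin d)}
    {y y' : Fin m → EuclideanSpace ℝ (Fin l)} {z : EuclideanSpace ℝ (Fin p)}
    (hy : ∀ j : Fin m, ∃ u : EuclideanSpace ℝ (Fin l),
      (∀ w, g j (y' j) + ⟪u, w - y' j⟫ ≤ g j w) ∧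
      u - adjoint (B j) z +
        ρ • adjoint (B j)
          (A x + (∑ i ∈ Finset.univ.filter (fun i => i ≤ j), B i (y' i))
            + (∑ i ∈ Finset.univ.filter (fun i => j < i), B i (y i)) - c) +
        H j (y' j - y j) = 0) :
    augLag F g A B c ρ x y' z ≤ augLag F g A B c ρ x y z
      - ∑ j, sInf (spectrum ℝ (H j)) * ‖y' j - y j‖ ^ 2 := by
  let Φ : EuclideanSpace ℝ (Fin p) → ℝ := fun v => -⟪z, v - c⟫ + ρ / 2 * ‖v - c‖ ^ 2
  have hblock : ∀ j, g j (y' j) + sInf (spectrum ℝ (H j)) * ‖y' j - y j‖ ^ 2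
      + (Φ (A x + (∑ i ∈ Finset.univ.filter (fun i => i ≤ j), B i (y' i))
          + ∑ i ∈ Finset.univ.filter (fun i => j < i), B i (y i))
        - Φ (A x + (∑ i ∈ Finset.univ.filter (fun i => i ≤ j), B i (y' i))
          + (∑ i ∈ Finset.univ.filter (fun i => j < i), B i (y i))
          - (B j (y' j) - B j (y j)))) ≤ g j (y j) := by
    intro j
    obtain ⟨u, hu, hopt⟩ := hy j
    have hsub := hu (y j)
    have hH' := sInf_spectrum_mul_norm_sq_le_inner (hH j) (y' j - y j)
    have hin := congrArg (fun v => ⟪v, y' j - y j⟫) hopt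
    set r := A x + (∑ i ∈ Finset.univ.filter (fun i => i ≤ j), B i (y' i))
      + (∑ i ∈ Finset.univ.filter (fun i => j < i), B i (y i))
    simp only [inner_add_left, inner_sub_left, real_inner_smul_left, adjoint_inner_left,
      inner_zero_left] at hin
    rw [← neg_sub (y' j) (y j), inner_neg_right] at hsub
    have hΦ : Φ r - Φ (r - (B j (y' j) - B j (y j))) = -⟪z, B j (y' j - y j)⟫
        + ρ * ⟪r - c, B j (y' j - y j)⟫ - ρ / 2 * ‖B j (y' j - y j)‖ ^ 2 := by
      simp only [Φ, ← map_sub, sub_right_comm r _ c, inner_sub_right z (r - c)]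
      rw [norm_sub_sq_real (r - c)]
      ring
    rw [hΦ]
    have hpos : 0 ≤ ρ / 2 * ‖B j (y' j - y j)‖ ^ 2 := by positivity
    rw [inner_sub_left]
    linarith
  have hsum := Finset.sum_le_sum fun j (_ : j ∈ Finset.univ) => hblock j
  rw [Finset.sum_add_distrib, Finset.sum_add_distrib,
    sum_sub_eq_of_replace_one_by_one Φ (A x) (fun i => B i (y' i)) (fun i => B i (y i))] at hsum
  simp only [Φ] at hsum
  unfold augLag
  linarith

/-- Decrease of the augmented Lagrangian under the inexact linearised `x`-update. -/
theorem augLag_primal_update_le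
    {G : EuclideanSpace ℝ (Fin d) →L[ℝ] EuclideanSpace ℝ (Fin d)} {η C L : ℝ}
    (hη : 0 < η) (hρ : 0 < ρ) (hL : 0 < L) (hF : Differentiable ℝ F)
    (hFlip : ∀ a b, ‖gradient F a - gradient F b‖ ≤ L * ‖a - b‖) (hG : IsSelfAdjoint G)
    {x x' v : EuclideanSpace ℝ (Fin d)} {y : Fin m → EuclideanSpace ℝ (Fin l)}
    {z : EuclideanSpace ℝ (Fin p)}
    (hx : v + η⁻¹ • G (x' - x) - adjoint A z +
        ρ • adjoint A (A x' + ∑ j, B j (y j) - c) = 0)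
    (hv : ‖v - gradient F x‖ ^ 2 ≤ C) :
    augLag F g A B c ρ x' y z ≤ augLag F g A B c ρ x y z
      - (sInf (spectrum ℝ G) / η + ρ * sInf (spectrum ℝ (adjoint A ∘L A)) / 2 - L)
        * ‖x' - x‖ ^ 2 + C / (2 * L) := by
  have hdesc := le_add_inner_gradient_add_of_lipschitz_gradient hF hFlip x (x' - x)
  rw [add_sub_cancel] at hdesc
  have hG' := mul_le_mul_of_nonneg_left (sInf_spectrum_mul_norm_sq_le_inner hG (x' - x))
    (inv_nonneg.2 hη.le)
  have hA' := mul_le_mul_of_nonneg_left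
    (sInf_spectrum_adjoint_comp_self_mul_norm_sq_le A (x' - x)) (half_pos hρ).le
  have hres : A x + ∑ j, B j (y j) - c = (A x' + ∑ j, B j (y j) - c) - A (x' - x) := by
    rw [map_sub]
    abel
  unfold augLag
  rw [hres]
  set r := A x' + ∑ j, B j (y j) - c
  have hin := congrArg (fun w => ⟪w, x' - x⟫) hx
  simp only [inner_add_left, inner_sub_left, real_inner_smul_left, adjoint_inner_left,
    inner_zero_left] at hin
  have hyoung : -⟪v - gradient F x, x' - x⟫ ≤ C / (2 * L) + L / 2 * ‖x' - x‖ ^ 2 := by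
    have hcs := (abs_le.1 (abs_real_inner_le_norm (v - gradient F x) (x' - x))).1
    have hCL : ‖v - gradient F x‖ ^ 2 / (2 * L) ≤ C / (2 * L) := by gcongr
    have hsq : 0 ≤ (‖v - gradient F x‖ - L * ‖x' - x‖) ^ 2 / (2 * L) := by positivity
    have hexp : (‖v - gradient F x‖ - L * ‖x' - x‖) ^ 2 / (2 * L)
        = ‖v - gradient F x‖ ^ 2 / (2 * L) - ‖v - gradient F x‖ * ‖x' - x‖
          + L / 2 * ‖x' - x‖ ^ 2 := by
      field_simp
      ring
    linarith
  rw [inner_sub_left] at hyoung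
  rw [inner_sub_right z r, norm_sub_sq_real r, div_eq_inv_mul _ η]
  linarith

end Steps

/-- One-step decrease of the potential
`R(x, x⁻, y, z) = L_ρ(x, y, z) + c_R ‖x − x⁻‖²` along one full iteration of the
stochastic ADMM with gradient-estimation error at most `C`. -/
theorem admm_potential_decrease {d l p m : ℕ}
    (F : EuclideanSpace ℝ (Fin d) → ℝ)
    (g : Fin m → EuclideanSpace ℝ (Fin l) → ℝ)
    (A : EuclideanSpace ℝ (Fin d) →L[ℝ] EuclideanSpace ℝ (Fin p))
    (B : Fin m → EuclideanSpace ℝ (Fin l) →L[ℝ] EuclideanSpace ℝ (Fin p))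
    (c : EuclideanSpace ℝ (Fin p))
    (G : EuclideanSpace ℝ (Fin d) →L[ℝ] EuclideanSpace ℝ (Fin d))
    (H : Fin m → (EuclideanSpace ℝ (Fin l) →L[ℝ] EuclideanSpace ℝ (Fin l)))
    (η ρ C L : ℝ) (hη : 0 < η) (hρ : 0 < ρ) (hC : 0 < C) (hL : 0 < L)
    (hF : Differentiable ℝ F)
    (hFlip : ∀ a b, ‖gradient F a - gradient F b‖ ≤ L * ‖a - b‖)
    (hg : ∀ j, ConvexOn ℝ Set.univ (g j))
    (lam : ℝ) (hlam_pos : 0 < lam)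
    (hlam : lam = sInf (spectrum ℝ (A ∘L adjoint A)))
    (σA : ℝ) (hσA : σA = sInf (spectrum ℝ (adjoint A ∘L A))) (hσA_nonneg : 0 ≤ σA)
    (hGsa : IsSelfAdjoint G) (lminG : ℝ)
    (hlminG : lminG = sInf (spectrum ℝ G)) (hGpsd : 0 ≤ lminG)
    (hHsa : ∀ j, IsSelfAdjoint (H j)) (lminH : Fin m → ℝ)
    (hlminH : ∀ j, lminH j = sInf (spectrum ℝ (H j))) (hHpd : ∀ j, 0 < lminH j)
    -- the iterates
    (xm xk xp vkm vk : EuclideanSpace ℝ (Fin d))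
    (yk yp : Fin m → EuclideanSpace ℝ (Fin l))
    (zk zp : EuclideanSpace ℝ (Fin p))
    -- (i) optimality of each block update
    (hy : ∀ j : Fin m, ∃ u : EuclideanSpace ℝ (Fin l),
      (∀ w, g j (yp j) + ⟪u, w - yp j⟫ ≤ g j w) ∧
      u - adjoint (B j) zk +
        ρ • adjoint (B j)
          (A xk + (∑ i ∈ Finset.univ.filter (fun i => i ≤ j), B i (yp i))
            + (∑ i ∈ Finset.univ.filter (fun i => j < i), B i (yk i)) - c) +
        H j (yp j - yk j) = 0)
    -- (ii) optimality of the x-update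
    (hx : vk + η⁻¹ • G (xp - xk) - adjoint A zk +
        ρ • adjoint A (A xp + ∑ j, B j (yp j) - c) = 0)
    -- (iii) dual update
    (hz : zp = zk - ρ • (A xp + ∑ j, B j (yp j) - c))
    -- (iv) optimality of the previous x-update
    (hzk : adjoint A zk = vkm + η⁻¹ • G (xk - xm))
    -- (v) gradient-estimation errors
    (hvk : ‖vk - gradient F xk‖ ^ 2 ≤ C)
    (hvkm : ‖vkm - gradient F xm‖ ^ 2 ≤ C) :
    augLag F g A B c ρ xp yp zp
        + (3 * ‖G‖ ^ 2 / (ρ * lam * η ^ 2) + 9 * L ^ 2 / (ρ * lam)) * ‖xp - xk‖ ^ 2 ≤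
      augLag F g A B c ρ xk yk zk
        + (3 * ‖G‖ ^ 2 / (ρ * lam * η ^ 2) + 9 * L ^ 2 / (ρ * lam)) * ‖xk - xm‖ ^ 2
        - (lminG / η + ρ * σA / 2 - L - 6 * ‖G‖ ^ 2 / (ρ * lam * η ^ 2)
            - 9 * L ^ 2 / (ρ * lam)) * ‖xp - xk‖ ^ 2
        - (∑ j, lminH j * ‖yp j - yk j‖ ^ 2)
        + C / (2 * L) + 18 * C / (ρ * lam) := by
  have hprimal := augLag_primal_update_le (g := g) hη hρ hL hF hFlip hGsa hx hvk
  have hblock := augLag_block_update_le (F := F) hρ hHsa hy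
  simp only [← hlminH] at hblock
  rw [← hlminG, ← hσA] at hprimal
  have hdual : augLag F g A B c ρ xp yp zp = augLag F g A B c ρ xp yp zk + ‖zp - zk‖ ^ 2 / ρ := by
    have hd : zp - zk = -(ρ • (A xp + ∑ j, B j (yp j) - c)) := by rw [hz]; abel
    rw [hd, norm_neg, norm_smul, mul_pow, Real.norm_eq_abs, sq_abs]
    unfold augLag
    rw [hz, inner_sub_left, real_inner_smul_left, real_inner_self_eq_norm_sq]
    field_simp
    ring
  have hzdiff : adjoint A (zp - zk) = (vk - vkm) + η⁻¹ • G (xp - xk) + -(η⁻¹ • G (xk - xm)) := by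
    have hzp : adjoint A zp = vk + η⁻¹ • G (xp - xk) := by
      rw [hz, map_sub, map_smul, ← sub_eq_zero, ← neg_eq_zero, ← hx]
      abel
    rw [map_sub, hzp, hzk]
    abel
  have hGnorm : ∀ w, ‖η⁻¹ • G w‖ ^ 2 ≤ ‖G‖ ^ 2 / η ^ 2 * ‖w‖ ^ 2 := by
    intro w
    rw [norm_smul, mul_pow, Real.norm_eq_abs, sq_abs, inv_pow, div_eq_inv_mul, mul_assoc,
      ← mul_pow]
    gcongr
    exact G.le_opNorm w
  have hvdiff : ‖vk - vkm‖ ^ 2 ≤ 6 * C + 3 * L ^ 2 * ‖xk - xm‖ ^ 2 := by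
    have hsplit : vk - vkm = (vk - gradient F xk) + (gradient F xk - gradient F xm)
        + -(vkm - gradient F xm) := by abel
    have h := norm_add_add_sq_le (vk - gradient F xk) (gradient F xk - gradient F xm)
      (-(vkm - gradient F xm))
    rw [← hsplit, norm_neg] at h
    have hgrad := pow_le_pow_left₀ (norm_nonneg _) (hFlip xk xm) 2
    rw [mul_pow] at hgrad
    linarith
  have hzbound : lam * ‖zp - zk‖ ^ 2 ≤ 18 * C + 9 * L ^ 2 * ‖xk - xm‖ ^ 2
      + 3 * (‖G‖ ^ 2 / η ^ 2) * (‖xp - xk‖ ^ 2 + ‖xk - xm‖ ^ 2) := by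
    have h := sInf_spectrum_comp_adjoint_mul_norm_sq_le A (zp - zk)
    have hthree := norm_add_add_sq_le (vk - vkm) (η⁻¹ • G (xp - xk)) (-(η⁻¹ • G (xk - xm)))
    rw [← hzdiff, norm_neg] at hthree
    rw [← hlam] at h
    linarith [hGnorm (xp - xk), hGnorm (xk - xm)]
  have hzdiv : ‖zp - zk‖ ^ 2 / ρ ≤ (18 * C + 9 * L ^ 2 * ‖xk - xm‖ ^ 2
      + 3 * (‖G‖ ^ 2 / η ^ 2) * (‖xp - xk‖ ^ 2 + ‖xk - xm‖ ^ 2)) / (ρ * lam) := by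
    rw [div_le_div_iff₀ hρ (mul_pos hρ hlam_pos)]
    nlinarith [mul_le_mul_of_nonneg_left hzbound hρ.le]
  have hexp : (18 * C + 9 * L ^ 2 * ‖xk - xm‖ ^ 2
      + 3 * (‖G‖ ^ 2 / η ^ 2) * (‖xp - xk‖ ^ 2 + ‖xk - xm‖ ^ 2)) / (ρ * lam)
      = 18 * C / (ρ * lam) + 9 * L ^ 2 / (ρ * lam) * ‖xk - xm‖ ^ 2
        + 3 * ‖G‖ ^ 2 / (ρ * lam * η ^ 2) * (‖xp - xk‖ ^ 2 + ‖xk - xm‖ ^ 2) := by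
    field_simp
  have hdouble : 6 * ‖G‖ ^ 2 / (ρ * lam * η ^ 2) = 2 * (3 * ‖G‖ ^ 2 / (ρ * lam * η ^ 2)) := by
    ring
  rw [hexp] at hzdiv
  rw [hdual, hdouble]
  linarith
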